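/- Let m ≥ 1, let α₁,…,α_m be real numbers with 0 < α_i < Q for each i, and let α = α₁+⋯+α_m. Then for all f_i ∈ H^∞_{α_i}(ℍⁿ), ‖P_m^{h*}(f₁,…,f_m)‖_{H^∞_α} ≤ ℬ_m^{h*} ∏_{i=1}^m ‖f_i‖_{H^∞_{α_i}}, where ℬ_m^{h*} := ∫_{(ℝ^{2n+1})^m} (∏_{i=1}^m |y_i|_h^{-α_i}) / (1 + |y₁|_h^Q + ⋯ + |y_m|_h^Q)^m dy₁⋯dy_m < ∞; in particular the m-linear Hilbert operator P_m^{h*} is bounded from H^∞_{α₁}(ℍⁿ)×⋯×H^∞_{α_m}(ℍⁿ) to H^∞_α(ℍⁿ). -/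

import Mathlib

open MeasureTheory ENNReal

/-- The Korányi (homogeneous) norm on the Heisenberg group `ℍⁿ ≃ ℝ^{2n+1}`. -/
noncomputable def hnorm (n : ℕ) (x : Fin (2*n+1) → ℝ) : ℝ :=
  ((∑ i : Fin (2*n+1), if (i : ℕ) < 2*n then (x i)^2 else 0)^2
    + (x (Fin.last (2*n)))^2) ^ ((1:ℝ)/4)

/-- The Heisenberg dilations `δ_r`. -/
noncomputable def dil (n : ℕ) (r : ℝ) (x : Fin (2*n+1) → ℝ) : Fin (2*n+1) → ℝ :=
  fun i => if (i : ℕ) < 2*n then r * x i else r^2 * x i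

/-- The norm of the weighted-type space `H^∞_α(ℍⁿ)`:
`‖f‖ = ess sup_x |x|_h^α |f x|`. -/
noncomputable def wnorm (n : ℕ) (α : ℝ) (f : (Fin (2*n+1) → ℝ) → ℝ) : ℝ≥0∞ :=
  essSup (fun x => ENNReal.ofReal (hnorm n x ^ α * |f x|)) volume

/-- `Ω_Q`: the volume of the Korányi unit ball. -/
noncomputable def ΩQ (n : ℕ) : ℝ :=
  (volume {x : Fin (2*n+1) → ℝ | hnorm n x < 1}).toReal


lemma aux_meas (n : ℕ) : Measurable (hnorm n) := by
  unfold hnorm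
  refine Measurable.pow_const (Measurable.add (Measurable.pow_const ?_ 2) (by fun_prop)) _
  refine Finset.measurable_sum _ fun i _ => ?_
  split_ifs <;> fun_prop

lemma aux_nonneg (n : ℕ) (x) : 0 ≤ hnorm n x := by
  unfold hnorm; positivity

lemma aux_pow4 (n : ℕ) (x) : hnorm n x ^ 4 =
    (∑ i : Fin (2*n+1), if (i : ℕ) < 2*n then (x i)^2 else 0)^2
    + (x (Fin.last (2*n)))^2 := by
  unfold hnorm
  rw [← Real.rpow_natCast, ← Real.rpow_mul (by positivity)]
  norm_num

lemma aux_last (n : ℕ) (x) : |x (Fin.last (2*n))| ≤ hnorm n x ^ 2 := by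
  apply abs_le_of_sq_le_sq _ (by positivity)
  have := aux_pow4 n x
  nlinarith [sq_nonneg (∑ i : Fin (2*n+1), if (i : ℕ) < 2*n then (x i)^2 else 0)]

lemma aux_coord (n : ℕ) (x) (i : Fin (2*n+1)) (hi : (i:ℕ) < 2*n) : |x i| ≤ hnorm n x := by
  have h1 : (x i)^2 ≤ ∑ i : Fin (2*n+1), if (i : ℕ) < 2*n then (x i)^2 else 0 := by
    have := Finset.single_le_sum (f := fun i : Fin (2*n+1) => if (i : ℕ) < 2*n then (x i)^2 else 0)
      (s := Finset.univ) (fun j _ => by split_ifs <;> positivity) (Finset.mem_univ i)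
    simpa [hi] using this
  have h4 := aux_pow4 n x
  have h2 : (x i)^2 ≤ (hnorm n x)^2 := by
    apply abs_le_of_sq_le_sq' _ (by positivity) |>.2
    have := pow_le_pow_left₀ (sq_nonneg (x i)) h1 2
    nlinarith [sq_nonneg (x (Fin.last (2*n)))]
  exact abs_le_of_sq_le_sq h2 (aux_nonneg n x)

lemma aux_dil (n : ℕ) (r : ℝ) (hr : 0 < r) (x) : hnorm n (dil n r x) = r * hnorm n x := by
  have h : hnorm n (dil n r x) ^ 4 = (r * hnorm n x) ^ 4 := by
    rw [mul_pow, aux_pow4, aux_pow4]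
    have : (∑ i : Fin (2*n+1), if (i : ℕ) < 2*n then (dil n r x i)^2 else 0)
      = r^2 * ∑ i : Fin (2*n+1), if (i : ℕ) < 2*n then (x i)^2 else 0 := by
      rw [Finset.mul_sum]
      refine Finset.sum_congr rfl fun i _ => ?_
      unfold dil
      split_ifs <;> ring
    rw [this]
    simp only [dil, Fin.val_last, lt_irrefl, if_false]
    ring
  exact (pow_left_inj₀ (aux_nonneg _ _) (mul_nonneg hr.le (aux_nonneg _ _)) (by norm_num)).1 h

/-- one-dimensional majorant -/
noncomputable def psi (a s : ℝ) : ℝ := |s| ^ (-a) * min 1 |s|⁻¹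

lemma psi_integrable (a : ℝ) (h0 : 0 < a) (h1 : a < 1) : Integrable (psi a) := by
  have hm : Measurable (psi a) := by unfold psi; fun_prop
  have hpos : IntegrableOn (psi a) (Set.Ioi 0) := by
    rw [← Set.Ioc_union_Ioi_eq_Ioi (zero_le_one (α := ℝ))]
    refine IntegrableOn.union ?_ ?_
    · have : IntegrableOn (fun x : ℝ => x ^ (-a)) (Set.Ioc 0 1) := by
        rw [← intervalIntegrable_iff_integrableOn_Ioc_of_le zero_le_one]
        exact intervalIntegral.intervalIntegrable_rpow' (by linarith)
      refine Integrable.mono' this hm.aestronglyMeasurable ?_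
      filter_upwards [ae_restrict_mem measurableSet_Ioc] with x hx
      have hx0 : 0 < x := hx.1
      unfold psi
      rw [abs_of_pos hx0, Real.norm_of_nonneg (by positivity)]
      exact mul_le_of_le_one_right (by positivity) (min_le_left _ _)
    · have : IntegrableOn (fun x : ℝ => x ^ (-a-1)) (Set.Ioi 1) :=
        integrableOn_Ioi_rpow_of_lt (by linarith) one_pos
      refine Integrable.mono' this hm.aestronglyMeasurable ?_
      filter_upwards [ae_restrict_mem measurableSet_Ioi] with x hx
      have hx0 : 0 < x := lt_trans one_pos hx
      unfold psi
      rw [abs_of_pos hx0, Real.norm_of_nonneg (by positivity), Real.rpow_sub hx0, Real.rpow_one,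
        div_eq_mul_inv]
      exact mul_le_mul_of_nonneg_left (min_le_right _ _) (by positivity)
  have hneg : IntegrableOn (psi a) (Set.Iio 0) := by
    have := hpos.comp_neg
    have h2 : (fun x => psi a (-x)) = psi a := by ext x; simp [psi]
    simpa [h2] using this
  rw [← integrableOn_univ, ← Set.Iio_union_Ici (a := (0:ℝ))]
  exact hneg.union ((integrableOn_Ici_iff_integrableOn_Ioi (by simp)).2 hpos)

lemma psi_lower (a : ℝ) (h0 : 0 < a) (s u : ℝ) (hs : s ≠ 0) (h : |s| ≤ u) :
    u ^ (-a) * min 1 u⁻¹ ≤ psi a s := by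
  have hs' : 0 < |s| := abs_pos.2 hs
  have hu : 0 < u := hs'.trans_le h
  unfold psi
  apply mul_le_mul
  · exact Real.rpow_le_rpow_of_nonpos hs' h (by linarith)
  · exact min_le_min le_rfl (inv_anti₀ hs' h)
  · positivity
  · positivity

lemma single_bound (n : ℕ) (α : ℝ) (h0 : 0 < α) (x : Fin (2*n+1) → ℝ)
    (hx : ∀ i, x i ≠ 0) :
    hnorm n x ^ (-α) / (1 + hnorm n x ^ ((2*n+2 : ℝ))) ≤ ∏ i, psi (α/(2*n+2)) (x i) := by
  have hl := aux_last n x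
  have hc := aux_coord n x
  set u := hnorm n x with hu
  have hu0 : 0 < u := by
    have h1 := abs_pos.2 (hx (Fin.last (2*n)))
    have h2 := aux_nonneg n x
    rcases h2.eq_or_lt with h | h
    · rw [hu, ← h] at hl; norm_num at hl; exact absurd hl (hx _)
    · exact h
  set a := α/(2*n+2) with ha
  have ha0 : 0 < a := by positivity
  have hQ : (0:ℝ) < 2*n+2 := by positivity
  rw [Fin.prod_univ_castSucc]
  have e1 : (u ^ (-a) * min 1 u⁻¹) ^ (2*n) ≤ ∏ i : Fin (2*n), psi a (x i.castSucc) := by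
    have : (u ^ (-a) * min 1 u⁻¹) ^ (2*n) = ∏ i : Fin (2*n), (u ^ (-a) * min 1 u⁻¹) := by simp
    rw [this]
    refine Finset.prod_le_prod (fun _ _ => by positivity) fun i _ => ?_
    exact psi_lower a ha0 _ u (hx _) (hc _ (by simp))
  have e2 : (u ^ (-a) * min 1 u⁻¹) ^ 2 ≤ psi a (x (Fin.last (2*n))) := by
    refine le_trans (le_of_eq ?_) (psi_lower a ha0 _ (u^2) (hx _) hl)
    rw [mul_pow]
    congr 1
    · rw [← Real.rpow_natCast, ← Real.rpow_mul hu0.le, ← Real.rpow_natCast u,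
        ← Real.rpow_mul hu0.le, mul_comm]
    · rcases le_total u 1 with h | h
      · rw [min_eq_left ((one_le_inv₀ hu0).2 h), min_eq_left
          ((one_le_inv₀ (by positivity)).2 (pow_le_one₀ hu0.le h))]; simp
      · rw [min_eq_right (inv_le_one_of_one_le₀ h), min_eq_right
          (inv_le_one_of_one_le₀ (one_le_pow₀ h)), inv_pow]
  refine le_trans ?_ (mul_le_mul e1 e2 (by positivity) (le_trans (by positivity) e1))
  rw [← pow_add, mul_pow, div_eq_mul_inv]
  have e3 : (u ^ (-a)) ^ (2*n+2) = u ^ (-α) := by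
    rw [← Real.rpow_natCast, ← Real.rpow_mul hu0.le]
    congr 1
    rw [ha]; push_cast; field_simp
  rw [e3]
  refine mul_le_mul_of_nonneg_left ?_ (by positivity)
  have e4 : u ^ (2*n+2 : ℝ) = u ^ (2*n+2 : ℕ) := by
    rw [← Real.rpow_natCast]; push_cast; rfl
  rw [e4]
  rcases le_total u 1 with h | h
  · rw [min_eq_left ((one_le_inv₀ hu0).2 h), one_pow]
    exact inv_le_one_of_one_le₀ (by have : 0 < u ^ (2*n+2) := by positivity
                                    linarith)
  · rw [min_eq_right (inv_le_one_of_one_le₀ h), inv_pow]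
    exact inv_anti₀ (by positivity) (by linarith)

lemma single_integrable (n : ℕ) (α : ℝ) (h0 : 0 < α) (h1 : α < 2*n+2) :
    Integrable (fun x => hnorm n x ^ (-α) / (1 + hnorm n x ^ ((2*n+2 : ℝ)))) := by
  have hm := aux_meas n
  have hQ : (0:ℝ) < 2*n+2 := by positivity
  have : Integrable (fun x : Fin (2*n+1) → ℝ => ∏ i, psi (α/(2*n+2)) (x i)) :=
    Integrable.fintype_prod (f := fun _ => psi (α/(2*n+2))) fun i =>
      psi_integrable _ (by positivity) ((div_lt_one hQ).2 h1)
  refine this.mono' (Measurable.aestronglyMeasurable (by fun_prop)) ?_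
  have hae : ∀ᵐ x : Fin (2*n+1) → ℝ, ∀ i, x i ≠ 0 := by
    rw [ae_all_iff]
    intro i
    exact Measure.ae_eval_ne (μ := fun _ => volume) i 0
  filter_upwards [hae] with x hx
  have := aux_nonneg n x
  rw [Real.norm_of_nonneg (by positivity)]
  exact single_bound n α h0 x hx

/-- kernel -/
noncomputable def GG (n m : ℕ) (α : Fin m → ℝ) (c : ℝ) (y : Fin m → Fin (2*n+1) → ℝ) : ℝ :=
  (∏ i, hnorm n (y i) ^ (-(α i))) / (c + ∑ i, hnorm n (y i) ^ (2*n+2 : ℝ)) ^ m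

lemma GG_meas (n m : ℕ) (α : Fin m → ℝ) (c : ℝ) : Measurable (GG n m α c) := by
  have hm := aux_meas n
  unfold GG
  fun_prop

lemma GG_integrable (n m : ℕ) (α : Fin m → ℝ) (hα : ∀ i, 0 < α i ∧ α i < 2*n+2) :
    Integrable (GG n m α 1) := by
  have : Integrable (fun y : Fin m → Fin (2*n+1) → ℝ =>
      ∏ i, hnorm n (y i) ^ (-(α i)) / (1 + hnorm n (y i) ^ ((2*n+2 : ℝ)))) :=
    Integrable.fintype_prod
      (f := fun i x => hnorm n x ^ (-(α i)) / (1 + hnorm n x ^ ((2*n+2 : ℝ)))) fun i =>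
      single_integrable n (α i) (hα i).1 (hα i).2
  refine this.mono' (GG_meas n m α 1).aestronglyMeasurable (ae_of_all _ fun y => ?_)
  have hp : ∀ i (b : ℝ), 0 ≤ hnorm n (y i) ^ b := fun i b => Real.rpow_nonneg (aux_nonneg n _) _
  have hs : 0 ≤ ∑ i, hnorm n (y i) ^ (2*n+2 : ℝ) := Finset.sum_nonneg fun i _ => hp i _
  have hpr : 0 ≤ ∏ i, hnorm n (y i) ^ (-(α i)) := Finset.prod_nonneg fun i _ => hp i _
  unfold GG
  rw [Real.norm_of_nonneg (by positivity), Finset.prod_div_distrib]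
  refine div_le_div_of_nonneg_left hpr (Finset.prod_pos fun i _ => by have := hp i (2*n+2); positivity) ?_
  calc _ ≤ ∏ i : Fin m, (1 + ∑ i, hnorm n (y i) ^ (2*n+2 : ℝ)) := by
        refine Finset.prod_le_prod (fun i _ => by have := hp i (2*n+2); positivity) fun i _ => ?_
        have := Finset.single_le_sum (f := fun i => hnorm n (y i) ^ (2*n+2 : ℝ))
          (fun i _ => hp i _) (Finset.mem_univ i)
        simpa using this
    _ = _ := by simp

/-- dilation as linear map -/
noncomputable def dilL (n : ℕ) (r : ℝ) : (Fin (2*n+1) → ℝ) →ₗ[ℝ] (Fin (2*n+1) → ℝ) :=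
  LinearMap.pi fun i =>
    ((if (i:ℕ) < 2*n then r else r^2) • (LinearMap.id : ℝ →ₗ[ℝ] ℝ)) ∘ₗ LinearMap.proj i

lemma dilL_apply (n : ℕ) (r : ℝ) (x) : dilL n r x = dil n r x := by
  ext i
  simp only [dilL, dil, LinearMap.pi_apply, LinearMap.comp_apply, LinearMap.smul_apply,
    LinearMap.id_apply, LinearMap.proj_apply, smul_eq_mul]
  split_ifs <;> rfl

lemma dilL_det (n : ℕ) (r : ℝ) : LinearMap.det (dilL n r) = r ^ (2*n+2) := by
  unfold dilL
  rw [LinearMap.det_pi, Fin.prod_univ_castSucc]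
  simp
  ring

noncomputable def DL (n m : ℕ) (r : ℝ) :
    (Fin m → Fin (2*n+1) → ℝ) →ₗ[ℝ] (Fin m → Fin (2*n+1) → ℝ) :=
  LinearMap.pi fun i => dilL n r ∘ₗ LinearMap.proj i

lemma DL_det (n m : ℕ) (r : ℝ) : LinearMap.det (DL n m r) = (r ^ (2*n+2)) ^ m := by
  unfold DL
  rw [LinearMap.det_pi]
  simp [dilL_det]

lemma GG_DL (n m : ℕ) (α : Fin m → ℝ) (r : ℝ) (hr : 0 < r) (y) :
    GG n m α (r ^ (2*n+2 : ℝ)) (DL n m r y) =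
      (r ^ (∑ i, α i))⁻¹ * ((r ^ (2*n+2)) ^ m)⁻¹ * GG n m α 1 y := by
  have e4 : r ^ (2*n+2 : ℝ) = r ^ (2*n+2 : ℕ) := by
    rw [← Real.rpow_natCast]; push_cast; rfl
  have h : ∀ i, hnorm n (DL n m r y i) = r * hnorm n (y i) := fun i => by
    rw [← aux_dil n r hr, ← dilL_apply]; rfl
  unfold GG
  simp_rw [h, Real.mul_rpow hr.le (aux_nonneg n _)]
  rw [Finset.prod_mul_distrib, ← Finset.mul_sum, ← Real.rpow_sum_of_pos hr, Finset.sum_neg_distrib,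
    Real.rpow_neg hr.le, ← mul_one_add, mul_pow, e4]
  rw [mul_div_mul_comm, div_eq_mul_inv (r ^ _)⁻¹]

lemma GG_scaled (n m : ℕ) (α : Fin m → ℝ) (hα : ∀ i, 0 < α i ∧ α i < 2*n+2)
    (r : ℝ) (hr : 0 < r) :
    Integrable (GG n m α (r ^ (2*n+2 : ℝ))) ∧
    ∫ y, GG n m α (r ^ (2*n+2 : ℝ)) y = (r ^ (∑ i, α i))⁻¹ * ∫ y, GG n m α 1 y := by
  have hd : LinearMap.det (DL n m r) ≠ 0 := by rw [DL_det]; positivity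
  have hmap := Measure.map_linearMap_addHaar_eq_smul_addHaar
    (volume : Measure (Fin m → Fin (2*n+1) → ℝ)) hd
  rw [DL_det, abs_of_pos (by positivity)] at hmap
  have hDm : Measurable (DL n m r) := (LinearMap.continuous_of_finiteDimensional _).measurable
  have hG := GG_meas n m α (r ^ (2*n+2 : ℝ))
  have hc : (0:ℝ) < ((r ^ (2*n+2)) ^ m)⁻¹ := by positivity
  constructor
  · have h1 : Integrable (GG n m α (r ^ (2*n+2 : ℝ)) ∘ DL n m r) := by
      have : GG n m α (r ^ (2*n+2 : ℝ)) ∘ DL n m r = fun y =>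
        (r ^ (∑ i, α i))⁻¹ * ((r ^ (2*n+2)) ^ m)⁻¹ * GG n m α 1 y := by
        ext y; exact GG_DL n m α r hr y
      rw [this]
      exact (GG_integrable n m α hα).const_mul _
    rw [← integrable_map_measure hG.aestronglyMeasurable hDm.aemeasurable, hmap,
      integrable_smul_measure (by simpa using hc) (by simp)] at h1
    exact h1
  · have h2 := integral_map (μ := volume) hDm.aemeasurable
      (f := GG n m α (r ^ (2*n+2 : ℝ))) hG.aestronglyMeasurable
    rw [hmap, integral_smul_measure, ENNReal.toReal_ofReal hc.le] at h2
    simp_rw [GG_DL n m α r hr] at h2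
    rw [integral_const_mul, smul_eq_mul, mul_comm (r ^ _)⁻¹, mul_assoc] at h2
    exact mul_left_cancel₀ hc.ne' h2

/-- boundedness of the `m`-linear Hilbert operator on the Heisenberg
group from `H^∞_{α₁} × ⋯ × H^∞_{α_m}` to `H^∞_α`, with finite constant `ℬ_m^{h*}`. -/
theorem statement15 (n : ℕ) (hn : 1 ≤ n) (m : ℕ) (hm : 1 ≤ m)
    (Q : ℝ) (hQ : Q = 2*n+2)
    (α : Fin m → ℝ) (hα : ∀ i, 0 < α i ∧ α i < Q)
    (B : ℝ)
    (hB : B = ∫ y : Fin m → Fin (2*n+1) → ℝ,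
      (∏ i, hnorm n (y i) ^ (-(α i))) / (1 + ∑ i, hnorm n (y i) ^ Q) ^ m)
    (f : Fin m → (Fin (2*n+1) → ℝ) → ℝ)
    (hfmeas : ∀ i, Measurable (f i))
    (hfnonneg : ∀ i, ∀ y, 0 ≤ f i y)
    (hffin : ∀ i, wnorm n (α i) (f i) < ⊤) :
    Integrable (fun y : Fin m → Fin (2*n+1) → ℝ =>
      (∏ i, hnorm n (y i) ^ (-(α i))) / (1 + ∑ i, hnorm n (y i) ^ Q) ^ m) ∧
    wnorm n (∑ i, α i)
        (fun x => ∫ y : Fin m → Fin (2*n+1) → ℝ,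
          (∏ i, f i (y i)) / (hnorm n x ^ Q + ∑ i, hnorm n (y i) ^ Q) ^ m)
      ≤ ENNReal.ofReal B * ∏ i, wnorm n (α i) (f i) := by
  have hα' : ∀ i, 0 < α i ∧ α i < 2*n+2 := by rw [← hQ]; exact hα
  subst hQ
  refine ⟨GG_integrable n m α hα', ?_⟩
  have hB' : B = ∫ y, GG n m α 1 y := hB
  have hp : ∀ x (b : ℝ), 0 ≤ hnorm n x ^ b := fun i b => Real.rpow_nonneg (aux_nonneg n _) _
  have hGn : ∀ c : ℝ, 0 ≤ c → ∀ y, 0 ≤ GG n m α c y := fun c hc y => by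
    have hs : 0 ≤ ∑ i, hnorm n (y i) ^ (2*n+2 : ℝ) := Finset.sum_nonneg fun i _ => hp _ _
    have hpr : 0 ≤ ∏ i, hnorm n (y i) ^ (-(α i)) := Finset.prod_nonneg fun i _ => hp _ _
    unfold GG; positivity
  have hB0 : 0 ≤ B := hB' ▸ integral_nonneg (hGn 1 zero_le_one)
  set N : Fin m → ℝ := fun i => (wnorm n (α i) (f i)).toReal with hN
  have hN0 : ∀ i, 0 ≤ N i := fun i => ENNReal.toReal_nonneg
  have hRHS : ENNReal.ofReal B * ∏ i, wnorm n (α i) (f i) = ENNReal.ofReal (B * ∏ i, N i) := by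
    rw [ENNReal.ofReal_mul hB0, ENNReal.ofReal_prod_of_nonneg fun i _ => hN0 i]
    congr 1
    exact Finset.prod_congr rfl fun i _ => (ENNReal.ofReal_toReal (hffin i).ne).symm
  rw [hRHS]
  have hbd : ∀ i, ∀ᵐ y : Fin (2*n+1) → ℝ, f i y ≤ N i * hnorm n y ^ (-(α i)) := by
    intro i
    have h0 : ∀ᵐ y : Fin (2*n+1) → ℝ, y (Fin.last (2*n)) ≠ 0 :=
      Measure.ae_eval_ne (μ := fun _ => volume) _ 0
    have h1 := ENNReal.ae_le_essSup (μ := volume)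
      (fun x => ENNReal.ofReal (hnorm n x ^ (α i) * |f i x|))
    filter_upwards [h0, h1] with y hy0 hy
    have hy' : hnorm n y ^ (α i) * |f i y| ≤ N i :=
      (ENNReal.ofReal_le_iff_le_toReal (hffin i).ne).1 hy
    rw [abs_of_nonneg (hfnonneg i y)] at hy'
    have hpos : 0 < hnorm n y := by
      have hl := aux_last n y
      rcases (aux_nonneg n y).eq_or_lt with h | h
      · rw [← h] at hl; norm_num at hl; exact absurd hl hy0
      · exact h
    rw [Real.rpow_neg hpos.le, ← div_eq_mul_inv, le_div_iff₀ (by positivity), mul_comm]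
    exact hy'
  have hbd' : ∀ᵐ y : Fin m → Fin (2*n+1) → ℝ, ∀ i,
      f i (y i) ≤ N i * hnorm n (y i) ^ (-(α i)) := by
    rw [ae_all_iff]
    intro i
    exact (Measure.quasiMeasurePreserving_eval
      (fun _ : Fin m => (volume : Measure (Fin (2*n+1) → ℝ))) i).ae (hbd i)
  have hS : 0 < ∑ i, α i := by
    haveI : Nonempty (Fin m) := ⟨⟨0, hm⟩⟩
    exact Finset.sum_pos (fun i _ => (hα i).1) Finset.univ_nonempty
  refine essSup_le_of_ae_le _ (ae_of_all _ fun x => ?_)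
  refine ENNReal.ofReal_le_ofReal ?_
  have hR0 : 0 ≤ B * ∏ i, N i := mul_nonneg hB0 (Finset.prod_nonneg fun i _ => hN0 i)
  rcases (aux_nonneg n x).eq_or_lt with h | hr
  · rw [← h, Real.zero_rpow hS.ne', zero_mul]; exact hR0
  obtain ⟨hI, hE⟩ := GG_scaled n m α hα' (hnorm n x) hr
  have hden : ∀ y : Fin m → Fin (2*n+1) → ℝ,
      0 ≤ hnorm n x ^ (2*n+2 : ℝ) + ∑ i, hnorm n (y i) ^ (2*n+2 : ℝ) := fun y =>
    add_nonneg (hp _ _) (Finset.sum_nonneg fun i _ => hp _ _)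
  have hnn : ∀ y : Fin m → Fin (2*n+1) → ℝ, 0 ≤ (∏ i, f i (y i)) /
      (hnorm n x ^ (2*n+2 : ℝ) + ∑ i, hnorm n (y i) ^ (2*n+2 : ℝ)) ^ m := fun y =>
    div_nonneg (Finset.prod_nonneg fun i _ => hfnonneg i _) (pow_nonneg (hden y) _)
  have hle : ∫ y : Fin m → Fin (2*n+1) → ℝ, (∏ i, f i (y i)) /
      (hnorm n x ^ (2*n+2 : ℝ) + ∑ i, hnorm n (y i) ^ (2*n+2 : ℝ)) ^ m ≤
      ∫ y, (∏ i, N i) * GG n m α (hnorm n x ^ (2*n+2 : ℝ)) y := by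
    refine integral_mono_of_nonneg (ae_of_all _ hnn) (hI.const_mul _) ?_
    filter_upwards [hbd'] with y hy
    unfold GG
    rw [← mul_div_assoc, ← Finset.prod_mul_distrib]
    exact div_le_div_of_nonneg_right
      (Finset.prod_le_prod (fun i _ => hfnonneg i _) fun i _ => hy i) (pow_nonneg (hden y) _)
  rw [integral_const_mul, hE, ← hB'] at hle
  rw [abs_of_nonneg (integral_nonneg hnn)]
  have hrs : 0 < hnorm n x ^ (∑ i, α i) := Real.rpow_pos_of_pos hr _
  calc _ ≤ hnorm n x ^ (∑ i, α i) * ((∏ i, N i) * ((hnorm n x ^ (∑ i, α i))⁻¹ * B)) :=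
        mul_le_mul_of_nonneg_left hle hrs.le
    _ = _ := by field_simp
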